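/- arXiv:1408.2142 — 3 statements merged into one kernel-verified Lean document; each statement's English description precedes it below -/
import Mathlib

section
/- Fix integers n ≥ 1 and k ≥ 1. For 0 ≤ r ≤ k let Sym^r denote the space of real arrays t^{μ₁…μ_r} (μ_i ∈ {1,…,n}) invariant under all permutations of the indices. Let A := ⊕_{r=0}^{k} Sym^r (configuration increments a^{(r)}), let C := ⊕_{l=0}^{k−1} C_l where C_l is the space of arrays c^{μ₁…μ_l λ} symmetric in μ₁…μ_l, and let D := ⊕_{l=0}^{k−1} D_l where D_l is the space of arrays d^{μ₁…μ_l λ}{}_ν symmetric in μ₁…μ_l. For ξ = (a, c, d) ∈ V := A ⊕ C ⊕ D define currents J^{(r)}(ξ) ∈ Sym^r by: J^{(0)}(ξ) := Σ_λ d^λ{}_λ; for 1 ≤ r ≤ k−1, J^{μ₁…μ_r}(ξ) := c^{(μ₁…μ_r)} + Σ_λ d^{μ₁…μ_r λ}{}_λ (round bracket = total symmetrization; the c-term comes from C_{r−1} and the d-term from D_r); and J^{μ₁…μ_k}(ξ) := c^{(μ₁…μ_k)} (from C_{k−1}). Define the alternating bilinear form Ω(ξ, ξ′) := Σ_{r=0}^{k}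 [ ⟨J^{(r)}(ξ), a′^{(r)}⟩ − ⟨J^{(r)}(ξ′), a^{(r)}⟩ ], where ⟨·,·⟩ is full index contraction. Then: (i) the radical of Ω is exactly {ξ ∈ V : a = 0 and J^{(r)}(ξ) = 0 for all 0 ≤ r ≤ k}; (ii) the map ξ ↦ (a, (J^{(r)}(ξ))_{r=0}^{k}) induces a linear isomorphism V/rad(Ω) ≅ A ⊕ (⊕_{r=0}^{k} Sym^r); (iii) the form induced by Ω on V/rad(Ω) is nondegenerate. -/
noncomputable section

open scoped BigOperators

/-- Rank-`m` arrays `t^{μ₁…μ_m}`. -/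
abbrev Arr (n m : ℕ) : Type := (Fin m → Fin n) → ℝ
/-- Arrays `c^{μ₁…μ_m λ}` with `m` group indices and one extra index `λ`. -/
abbrev ArrC (n m : ℕ) : Type := (Fin m → Fin n) → Fin n → ℝ
/-- Arrays `d^{μ₁…μ_m λ}{}_ν`. -/
abbrev ArrD (n m : ℕ) : Type := (Fin m → Fin n) → Fin n → Fin n → ℝ

/-- The subspace `Sym^m` of totally symmetric rank-`m` arrays. -/
def SymA (n m : ℕ) : Submodule ℝ (Arr n m) where
  carrier := {t | ∀ (σ : Equiv.Perm (Fin m)) (s : Fin m → Fin n), t (s ∘ σ) = t s}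
  add_mem' := by intro a b ha hb σ s; simp [ha σ s, hb σ s]
  zero_mem' := by intro σ s; rfl
  smul_mem' := by intro c a ha σ s; simp [ha σ s]

/-- The space `C_m` of arrays `c^{μ₁…μ_m λ}` symmetric in `μ₁…μ_m`. -/
def SymC (n m : ℕ) : Submodule ℝ (ArrC n m) where
  carrier := {c | ∀ (σ : Equiv.Perm (Fin m)) (t : Fin m → Fin n) (lam : Fin n),
    c (t ∘ σ) lam = c t lam}
  add_mem' := by intro a b ha hb σ t lam; simp [ha σ t lam, hb σ t lam]
  zero_mem' := by intro σ t lam; rfl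
  smul_mem' := by intro k a ha σ t lam; simp [ha σ t lam]

/-- The space `D_m` of arrays `d^{μ₁…μ_m λ}{}_ν` symmetric in `μ₁…μ_m`. -/
def SymD (n m : ℕ) : Submodule ℝ (ArrD n m) where
  carrier := {d | ∀ (σ : Equiv.Perm (Fin m)) (t : Fin m → Fin n) (lam nu : Fin n),
    d (t ∘ σ) lam nu = d t lam nu}
  add_mem' := by intro a b ha hb σ t lam nu; simp [ha σ t lam nu, hb σ t lam nu]
  zero_mem' := by intro σ t lam nu; rfl
  smul_mem' := by intro k a ha σ t lam nu; simp [ha σ t lam nu]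

/-- `A = ⊕_{r=0}^{k} Sym^r`. -/
abbrev SpA (n k : ℕ) : Type := ∀ r : Fin (k + 1), ↥(SymA n (r : ℕ))
/-- `C = ⊕_{l=0}^{k−1} C_l`. -/
abbrev SpC (n k : ℕ) : Type := ∀ l : Fin k, ↥(SymC n (l : ℕ))
/-- `D = ⊕_{l=0}^{k−1} D_l`. -/
abbrev SpD (n k : ℕ) : Type := ∀ l : Fin k, ↥(SymD n (l : ℕ))

/-- `V = A ⊕ C ⊕ D` for a `(K+1)`-th order theory. -/
abbrev V1 (n K : ℕ) : Type := SpA n (K + 1) × SpC n (K + 1) × SpD n (K + 1)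

/-- The array `c^{μ₁…μ_l λ}` viewed as a rank-`(l+1)` array. -/
def comb (n l : ℕ) (q : ArrC n l) : Arr n (l + 1) :=
  fun s => q (fun i => s (Fin.castSucc i)) (s (Fin.last l))

/-- Total symmetrization of a rank-`m` array. -/
def symArr (n m : ℕ) (q : Arr n m) : Arr n m :=
  fun s => (m.factorial : ℝ)⁻¹ * ∑ σ : Equiv.Perm (Fin m), q (s ∘ σ)

lemma symArr_mem (n m : ℕ) (q : Arr n m) : symArr n m q ∈ SymA n m := by
  intro σ₀ s
  unfold symArr
  congr 1
  calc ∑ σ : Equiv.Perm (Fin m), q ((s ∘ σ₀) ∘ σ)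
      = ∑ σ : Equiv.Perm (Fin m), q (s ∘ ((Equiv.mulLeft σ₀) σ)) := by
        refine Finset.sum_congr rfl fun σ _ => ?_
        congr 1
    _ = ∑ σ : Equiv.Perm (Fin m), q (s ∘ σ) :=
        Equiv.sum_comp (Equiv.mulLeft σ₀) (fun τ : Equiv.Perm (Fin m) => q (s ∘ ⇑τ))

/-- The current `J^{(0)} = Σ_λ d^λ{}_λ`. -/
def Jlow (n K : ℕ) (ξ : V1 n K) : ℝ :=
  ∑ lam : Fin n, (ξ.2.2 ⟨0, Nat.succ_pos K⟩ : ArrD n 0) Fin.elim0 lam lam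

/-- The current `J^{μ₁…μ_r}` of rank `r = l+1 ≥ 1`:
`J = c^{(μ₁…μ_r)} + Σ_λ d^{μ₁…μ_r λ}{}_λ` for `1 ≤ r ≤ k−1`, and
`J = c^{(μ₁…μ_k)}` for `r = k`. -/
def Jhigh (n K : ℕ) (ξ : V1 n K) (l : Fin (K + 1)) : Arr n ((l : ℕ) + 1) :=
  fun s =>
    symArr n ((l : ℕ) + 1) (comb n (l : ℕ) (ξ.2.1 l : ArrC n (l : ℕ))) s
      + (if h : (l : ℕ) + 1 < K + 1 then
          ∑ lam : Fin n, (ξ.2.2 ⟨(l : ℕ) + 1, h⟩ : ArrD n ((l : ℕ) + 1)) s lam lam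
        else 0)

lemma Jhigh_mem (n K : ℕ) (ξ : V1 n K) (l : Fin (K + 1)) :
    Jhigh n K ξ l ∈ SymA n ((l : ℕ) + 1) := by
  intro σ s
  unfold Jhigh
  rw [symArr_mem n ((l : ℕ) + 1) (comb n (l : ℕ) (ξ.2.1 l : ArrC n (l : ℕ))) σ s]
  congr 1
  by_cases h : (l : ℕ) + 1 < K + 1
  · simp only [dif_pos h]
    exact Finset.sum_congr rfl fun lam _ => (ξ.2.2 ⟨(l : ℕ) + 1, h⟩).2 σ s lam lam
  · simp only [dif_neg h]

/-- The family of currents `(J^{(r)}(ξ))_{r=0}^{k}`, as an element of `⊕ Sym^r`. -/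
def Jfam (n K : ℕ) (ξ : V1 n K) : SpA n (K + 1) := fun r =>
  Fin.cases (motive := fun r : Fin (K + 2) => ↥(SymA n (r : ℕ)))
    ⟨fun _ => Jlow n K ξ, fun _ _ => rfl⟩
    (fun l => ⟨Jhigh n K ξ l, Jhigh_mem n K ξ l⟩) r

lemma Jlow_add (n K : ℕ) (ξ η : V1 n K) :
    Jlow n K (ξ + η) = Jlow n K ξ + Jlow n K η := by
  unfold Jlow
  rw [← Finset.sum_add_distrib]
  rfl

lemma Jlow_smul (n K : ℕ) (c : ℝ) (ξ : V1 n K) :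
    Jlow n K (c • ξ) = c * Jlow n K ξ := by
  unfold Jlow
  rw [Finset.mul_sum]
  rfl

lemma Jhigh_add (n K : ℕ) (ξ η : V1 n K) (l : Fin (K + 1)) :
    Jhigh n K (ξ + η) l = Jhigh n K ξ l + Jhigh n K η l := by
  funext s
  show Jhigh n K (ξ + η) l s = Jhigh n K ξ l s + Jhigh n K η l s
  unfold Jhigh symArr
  have hc : ∑ σ : Equiv.Perm (Fin ((l : ℕ) + 1)),
        comb n (l : ℕ) (((ξ + η).2.1 l : ArrC n (l : ℕ))) (s ∘ σ)
      = (∑ σ : Equiv.Perm (Fin ((l : ℕ) + 1)),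
          comb n (l : ℕ) ((ξ.2.1 l : ArrC n (l : ℕ))) (s ∘ σ))
        + ∑ σ : Equiv.Perm (Fin ((l : ℕ) + 1)),
            comb n (l : ℕ) ((η.2.1 l : ArrC n (l : ℕ))) (s ∘ σ) := by
    rw [← Finset.sum_add_distrib]
    rfl
  rw [hc, mul_add]
  by_cases h : (l : ℕ) + 1 < K + 1
  · simp only [dif_pos h]
    have hd : ∑ lam : Fin n, ((ξ + η).2.2 ⟨(l : ℕ) + 1, h⟩ : ArrD n ((l : ℕ) + 1)) s lam lam
        = (∑ lam : Fin n, (ξ.2.2 ⟨(l : ℕ) + 1, h⟩ : ArrD n ((l : ℕ) + 1)) s lam lam)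
          + ∑ lam : Fin n, (η.2.2 ⟨(l : ℕ) + 1, h⟩ : ArrD n ((l : ℕ) + 1)) s lam lam := by
      rw [← Finset.sum_add_distrib]
      rfl
    rw [hd]
    ring
  · simp only [dif_neg h]
    ring

lemma Jhigh_smul (n K : ℕ) (c : ℝ) (ξ : V1 n K) (l : Fin (K + 1)) :
    Jhigh n K (c • ξ) l = c • Jhigh n K ξ l := by
  funext s
  show Jhigh n K (c • ξ) l s = c * Jhigh n K ξ l s
  unfold Jhigh symArr
  have hc : ∑ σ : Equiv.Perm (Fin ((l : ℕ) + 1)),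
        comb n (l : ℕ) (((c • ξ).2.1 l : ArrC n (l : ℕ))) (s ∘ σ)
      = c * ∑ σ : Equiv.Perm (Fin ((l : ℕ) + 1)),
          comb n (l : ℕ) ((ξ.2.1 l : ArrC n (l : ℕ))) (s ∘ σ) := by
    rw [Finset.mul_sum]
    rfl
  rw [hc]
  by_cases h : (l : ℕ) + 1 < K + 1
  · simp only [dif_pos h]
    have hd : ∑ lam : Fin n, ((c • ξ).2.2 ⟨(l : ℕ) + 1, h⟩ : ArrD n ((l : ℕ) + 1)) s lam lam
        = c * ∑ lam : Fin n, (ξ.2.2 ⟨(l : ℕ) + 1, h⟩ : ArrD n ((l : ℕ) + 1)) s lam lam := by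
      rw [Finset.mul_sum]
      rfl
    rw [hd]
    ring
  · simp only [dif_neg h]
    ring

lemma Jfam_add (n K : ℕ) (ξ η : V1 n K) :
    Jfam n K (ξ + η) = Jfam n K ξ + Jfam n K η := by
  funext r
  refine Fin.cases ?_ ?_ r
  · apply Subtype.ext
    show (fun _ => Jlow n K (ξ + η)) = _
    funext t
    show Jlow n K (ξ + η) = Jlow n K ξ + Jlow n K η
    exact Jlow_add n K ξ η
  · intro l
    apply Subtype.ext
    show Jhigh n K (ξ + η) l = _
    rw [Jhigh_add]
    rfl

lemma Jfam_smul (n K : ℕ) (c : ℝ) (ξ : V1 n K) :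
    Jfam n K (c • ξ) = c • Jfam n K ξ := by
  funext r
  refine Fin.cases ?_ ?_ r
  · apply Subtype.ext
    funext t
    show Jlow n K (c • ξ) = c * Jlow n K ξ
    exact Jlow_smul n K c ξ
  · intro l
    apply Subtype.ext
    show Jhigh n K (c • ξ) l = _
    rw [Jhigh_smul]
    rfl

/-- The linear map `ξ ↦ (a, (J^{(r)}(ξ))_r)` whose kernel is the radical of `Ω`. -/
def Theta (n K : ℕ) : V1 n K →ₗ[ℝ] (SpA n (K + 1) × SpA n (K + 1)) where
  toFun ξ := (ξ.1, Jfam n K ξ)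
  map_add' ξ η := by
    refine Prod.ext rfl ?_
    exact Jfam_add n K ξ η
  map_smul' c ξ := by
    refine Prod.ext rfl ?_
    exact Jfam_smul n K c ξ

/-- The alternating bilinear form
`Ω(ξ,ξ') = Σ_{r=0}^{k} [⟨J^{(r)}(ξ), a'^{(r)}⟩ − ⟨J^{(r)}(ξ'), a^{(r)}⟩]`,
where `⟨·,·⟩` is full index contraction. -/
def Omega1 (n K : ℕ) (ξ ξ' : V1 n K) : ℝ :=
  (Jlow n K ξ * (ξ'.1 ⟨0, Nat.succ_pos (K + 1)⟩ : Arr n 0) Fin.elim0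
      - Jlow n K ξ' * (ξ.1 ⟨0, Nat.succ_pos (K + 1)⟩ : Arr n 0) Fin.elim0)
  + ∑ l : Fin (K + 1), ∑ s : Fin ((l : ℕ) + 1) → Fin n,
      (Jhigh n K ξ l s
          * (ξ'.1 ⟨(l : ℕ) + 1, Nat.succ_lt_succ l.isLt⟩ : Arr n ((l : ℕ) + 1)) s
        - Jhigh n K ξ' l s
          * (ξ.1 ⟨(l : ℕ) + 1, Nat.succ_lt_succ l.isLt⟩ : Arr n ((l : ℕ) + 1)) s)

lemma symArr_of_mem {n m : ℕ} {q : Arr n m} (hq : q ∈ SymA n m) : symArr n m q = q := by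
  funext s
  have h : ∀ σ : Equiv.Perm (Fin m), q (s ∘ σ) = q s := fun σ => hq σ s
  simp [symArr, h, Fintype.card_perm, Nat.factorial_ne_zero]

/-- A permutation of the first `m` indices, extended by fixing the last one. -/
def extendLast {m : ℕ} (σ : Equiv.Perm (Fin m)) : Equiv.Perm (Fin (m + 1)) :=
  (finSuccEquivLast.trans (Equiv.optionCongr σ)).trans finSuccEquivLast.symm

lemma snoc_comp_extendLast {n m : ℕ} (σ : Equiv.Perm (Fin m)) (t : Fin m → Fin n)
    (lam : Fin n) :
    (Fin.snoc t lam : Fin (m + 1) → Fin n) ∘ extendLast σ = Fin.snoc (t ∘ σ) lam := by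
  funext i
  refine Fin.lastCases ?_ (fun j => ?_) i <;> simp [extendLast]

/-- A symmetric rank-`(m+1)` array, viewed as an element of `C_m`. -/
def splitLast {n m : ℕ} (b : SymA n (m + 1)) : SymC n m :=
  ⟨fun t lam => (b : Arr n (m + 1)) (Fin.snoc t lam), fun σ t lam => by
    change (b : Arr n (m + 1)) (Fin.snoc (t ∘ σ) lam) = _
    rw [← snoc_comp_extendLast]
    exact b.2 (extendLast σ) _⟩

lemma comb_splitLast {n m : ℕ} (b : SymA n (m + 1)) :
    comb n m (splitLast b : ArrC n m) = b := by
  funext s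
  exact congrArg (b : Arr n (m + 1)) (Fin.snoc_init_self s)

/-- The array in `D_m` whose only nonzero component is `x`, at `λ = ν = i₀`, for every choice of
the group indices. -/
def diagD {n : ℕ} (m : ℕ) (i₀ : Fin n) (x : ℝ) : SymD n m :=
  ⟨fun _ lam nu => if lam = i₀ ∧ nu = i₀ then x else 0, fun _ _ _ _ => rfl⟩

lemma Theta_surjective (n K : ℕ) (hn : 1 ≤ n) : Function.Surjective (Theta n K) := by
  rintro ⟨a, b⟩
  let i₀ : Fin n := ⟨0, hn⟩
  refine ⟨(a, fun l => splitLast (b ⟨(l : ℕ) + 1, Nat.succ_lt_succ l.isLt⟩),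
    fun l => diagD l i₀
      (if (l : ℕ) = 0 then (b ⟨0, Nat.succ_pos (K + 1)⟩ : Arr n 0) Fin.elim0 else 0)), ?_⟩
  refine Prod.ext rfl (funext fun r => Subtype.ext ?_)
  refine Fin.cases ?_ (fun l => ?_) r
  · funext s
    obtain rfl : s = Fin.elim0 := funext fun i => i.elim0
    change Jlow n K _ = _
    simp [Jlow, diagD, ite_and]
  · change Jhigh n K _ l = _
    funext s
    simp only [Jhigh, comb_splitLast, symArr_of_mem (Subtype.property _)]
    simp [diagD]
    rfl

/-- Full index contraction on `⊕ Sym^r`. -/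
def contract (n K : ℕ) (x y : SpA n (K + 1)) : ℝ :=
  (x ⟨0, Nat.succ_pos (K + 1)⟩ : Arr n 0) Fin.elim0
    * (y ⟨0, Nat.succ_pos (K + 1)⟩ : Arr n 0) Fin.elim0
  + ∑ l : Fin (K + 1), ∑ s : Fin ((l : ℕ) + 1) → Fin n,
      (x ⟨(l : ℕ) + 1, Nat.succ_lt_succ l.isLt⟩ : Arr n ((l : ℕ) + 1)) s
        * (y ⟨(l : ℕ) + 1, Nat.succ_lt_succ l.isLt⟩ : Arr n ((l : ℕ) + 1)) s

lemma contract_neg_left (n K : ℕ) (x y : SpA n (K + 1)) :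
    contract n K (-x) y = -contract n K x y := by
  simp only [contract, neg_add, ← Finset.sum_neg_distrib, ← neg_mul]
  rfl

lemma contract_self_nonneg (n K : ℕ) (x : SpA n (K + 1)) : 0 ≤ contract n K x x :=
  add_nonneg (mul_self_nonneg _)
    (Finset.sum_nonneg fun _ _ => Finset.sum_nonneg fun _ _ => mul_self_nonneg _)

lemma eq_zero_of_contract_self {n K : ℕ} {x : SpA n (K + 1)} (h : contract n K x x = 0) :
    x = 0 := by
  have hnn : ∀ l : Fin (K + 1), 0 ≤ ∑ s : Fin ((l : ℕ) + 1) → Fin n,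
      (x ⟨(l : ℕ) + 1, Nat.succ_lt_succ l.isLt⟩ : Arr n ((l : ℕ) + 1)) s
        * (x ⟨(l : ℕ) + 1, Nat.succ_lt_succ l.isLt⟩ : Arr n ((l : ℕ) + 1)) s :=
    fun _ => Finset.sum_nonneg fun _ _ => mul_self_nonneg _
  obtain ⟨h0, h1⟩ := (add_eq_zero_iff_of_nonneg (mul_self_nonneg _)
    (Finset.sum_nonneg fun l _ => hnn l)).1 h
  refine funext fun r => Subtype.ext (Fin.cases ?_ (fun l => ?_) r)
  · funext s
    obtain rfl : s = Fin.elim0 := funext fun i => i.elim0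
    exact mul_self_eq_zero.1 h0
  · funext s
    have h2 := (Finset.sum_eq_zero_iff_of_nonneg fun l _ => hnn l).1 h1 l (Finset.mem_univ l)
    exact mul_self_eq_zero.1 ((Finset.sum_eq_zero_iff_of_nonneg fun _ _ =>
      mul_self_nonneg _).1 h2 s (Finset.mem_univ s))

/-- The canonical symplectic form on `A ⊕ (⊕ Sym^r)`. -/
def canonicalForm (n K : ℕ) (p q : SpA n (K + 1) × SpA n (K + 1)) : ℝ :=
  contract n K p.2 q.1 - contract n K q.2 p.1

lemma canonicalForm_nondegenerate {n K : ℕ} {p : SpA n (K + 1) × SpA n (K + 1)}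
    (h : ∀ q, canonicalForm n K p q = 0) : p = 0 := by
  have h1 : contract n K p.2 p.2 + contract n K p.1 p.1 = 0 := by
    simpa [canonicalForm, contract_neg_left] using h (p.2, -p.1)
  obtain ⟨hJ, ha⟩ := (add_eq_zero_iff_of_nonneg (contract_self_nonneg n K _)
    (contract_self_nonneg n K _)).1 h1
  exact Prod.ext (eq_zero_of_contract_self ha) (eq_zero_of_contract_self hJ)

lemma Omega1_eq_canonicalForm (n K : ℕ) (ξ ξ' : V1 n K) :
    Omega1 n K ξ ξ' = canonicalForm n K (Theta n K ξ) (Theta n K ξ') := by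
  simp only [Omega1, canonicalForm, contract, Finset.sum_sub_distrib]
  rw [add_sub_add_comm]
  rfl

lemma Theta_eq_zero_iff (n K : ℕ) (ξ : V1 n K) :
    Theta n K ξ = 0
      ↔ (ξ.1 = 0 ∧ Jlow n K ξ = 0 ∧ ∀ l : Fin (K + 1), Jhigh n K ξ l = 0) := by
  refine ⟨fun h => ?_, fun ⟨ha, h0, hl⟩ => ?_⟩
  · have hJ : Jfam n K ξ = 0 := congrArg Prod.snd h
    exact ⟨congrArg Prod.fst h,
      congrFun (congrArg Subtype.val (congrFun hJ 0)) Fin.elim0,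
      fun l => congrArg Subtype.val (congrFun hJ l.succ)⟩
  · refine Prod.ext ha (funext fun r => Subtype.ext (Fin.cases ?_ (fun l => hl l) r))
    exact funext fun _ => h0

/-- higher-order fibrewise pre-symplectic structure.
(i) the radical of `Ω` is exactly `{ξ : a = 0 and J^{(r)}(ξ) = 0 for all r}`
(= the kernel of `Θ : ξ ↦ (a, (J^{(r)}(ξ))_r)`);
(ii) `Θ` induces a linear isomorphism `V/rad(Ω) ≅ A ⊕ (⊕_{r=0}^{k} Sym^r)`;
(iii) the form induced by `Ω` on `V/rad(Ω)` is (alternating and) nondegenerate. -/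
theorem statement_1 (n K : ℕ) (hn : 1 ≤ n) :
    -- (i) the radical of Ω is {a = 0, J = 0}
    (∀ ξ : V1 n K,
      (∀ ξ' : V1 n K, Omega1 n K ξ ξ' = 0)
        ↔ (ξ.1 = 0 ∧ Jlow n K ξ = 0 ∧ ∀ l : Fin (K + 1), Jhigh n K ξ l = 0))
    ∧ (∀ ξ : V1 n K,
        Theta n K ξ = 0
          ↔ (ξ.1 = 0 ∧ Jlow n K ξ = 0 ∧ ∀ l : Fin (K + 1), Jhigh n K ξ l = 0))
    -- (ii) ξ ↦ (a, J(ξ)) induces a linear isomorphism V/rad(Ω) ≅ A ⊕ (⊕ Sym^r)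
    ∧ (∃ e : (V1 n K ⧸ LinearMap.ker (Theta n K))
          ≃ₗ[ℝ] (SpA n (K + 1) × SpA n (K + 1)),
        ∀ ξ : V1 n K, e (Submodule.Quotient.mk ξ) = Theta n K ξ)
    -- (iii) the induced form on V/rad(Ω) is nondegenerate
    ∧ ∃ B : (V1 n K ⧸ LinearMap.ker (Theta n K))
          → (V1 n K ⧸ LinearMap.ker (Theta n K)) → ℝ,
        (∀ ξ ξ' : V1 n K,
          B (Submodule.Quotient.mk ξ) (Submodule.Quotient.mk ξ') = Omega1 n K ξ ξ')
        ∧ (∀ q, B q q = 0)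
        ∧ (∀ q, (∀ q', B q q' = 0) → q = 0) := by
  have hsurj := Theta_surjective n K hn
  let e := (Theta n K).quotKerEquivOfSurjective hsurj
  have he : ∀ ξ : V1 n K, e (Submodule.Quotient.mk ξ) = Theta n K ξ := fun _ => rfl
  refine ⟨fun ξ => ?_, Theta_eq_zero_iff n K, ⟨e, he⟩,
    fun q q' => canonicalForm n K (e q) (e q'), fun ξ ξ' => ?_, fun q => sub_self _,
    fun q hq => ?_⟩
  · rw [← Theta_eq_zero_iff]
    refine ⟨fun h => canonicalForm_nondegenerate fun q => ?_, fun h ξ' => ?_⟩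
    · obtain ⟨ξ', rfl⟩ := hsurj q
      rw [← Omega1_eq_canonicalForm, h]
    · rw [Omega1_eq_canonicalForm, h]
      simp [canonicalForm, contract]
      exact (congrArg₂ (· - ·) (zero_mul _) (mul_zero _)).trans (sub_zero 0)
  · exact (Omega1_eq_canonicalForm n K ξ ξ').symm
  · refine e.map_eq_zero_iff.1 (canonicalForm_nondegenerate fun p => ?_)
    simpa using hq (e.symm p)
end
end

section
/- Let E be a finite-dimensional real vector space, g = (g_1, …, g_k) : E → ℝ^k a twice continuously differentiable map, and L̃ : E → ℝ twice continuously differentiable. Let x ∈ E be a point with g(x) = 0 at which the derivative dg_x : E → ℝ^k is surjective, and let λ ∈ ℝ^k. Equip E × E* with the canonical symplectic bilinear form ω((v, α), (w, β)) := β(v) − α(w). Then the set of vectors T := { ( w , D²L̃(x)(w, ·) + Σ_a λ_a D²g_a(x)(w, ·) + Σ_a μ_a (dg_a)_x ) : w ∈ ker dg_x, μ ∈ ℝ^k } is a linear subspace of E × E* of dimension exactly dim E on which ω vanishes identically; i.e. T is a Lagrangian subspace of E × E*. -/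
noncomputable section

/-- The canonical symplectic bilinear form on `E × E*`:
`ω((v,α),(w,β)) = β(v) − α(w)`. -/
def canSymp (E : Type) [NormedAddCommGroup E] [NormedSpace ℝ E]
    (u v : E × (E →L[ℝ] ℝ)) : ℝ :=
  v.2 u.1 - u.2 v.1

/-- The linear map `(w, μ) ↦ (w, H w + ∑ a, μ a • ξ a)` on `(⋂ a, ker (ξ a)) × ℝ^k`. -/
def conormalParam {E : Type} [NormedAddCommGroup E] [NormedSpace ℝ E] {k : ℕ}
    (H : E →L[ℝ] E →L[ℝ] ℝ) (ξ : Fin k → E →L[ℝ] ℝ) :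
    (LinearMap.ker (LinearMap.pi fun a => (ξ a : E →ₗ[ℝ] ℝ)) × (Fin k → ℝ)) →ₗ[ℝ]
      E × (E →L[ℝ] ℝ) where
  toFun p := (p.1, H p.1 + ∑ a, p.2 a • ξ a)
  map_add' p q := by
    ext1
    · simp
    · simp only [Prod.fst_add, Prod.snd_add, Submodule.coe_add, map_add, Pi.add_apply, add_smul,
        Finset.sum_add_distrib]
      abel
  map_smul' c p := by
    ext1
    · simp
    · simp [Finset.smul_sum, smul_smul]

theorem conormalParam_apply {E : Type} [NormedAddCommGroup E] [NormedSpace ℝ E] {k : ℕ}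
    (H : E →L[ℝ] E →L[ℝ] ℝ) (ξ : Fin k → E →L[ℝ] ℝ)
    (p : LinearMap.ker (LinearMap.pi fun a => (ξ a : E →ₗ[ℝ] ℝ)) × (Fin k → ℝ)) :
    conormalParam H ξ p = ((p.1 : E), H p.1 + ∑ a, p.2 a • ξ a) :=
  rfl

theorem conormalParam_injective {E : Type} [NormedAddCommGroup E] [NormedSpace ℝ E] {k : ℕ}
    (H : E →L[ℝ] E →L[ℝ] ℝ) (ξ : Fin k → E →L[ℝ] ℝ)
    (hξ : Function.Surjective fun v : E => (fun a => ξ a v : Fin k → ℝ)) :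
    Function.Injective (conormalParam H ξ) := by
  rw [injective_iff_map_eq_zero]
  rintro ⟨w, μ⟩ h
  obtain ⟨hw, hμ⟩ := Prod.mk.inj h
  obtain rfl : w = 0 := Subtype.ext hw
  refine Prod.ext rfl (funext fun a => ?_)
  obtain ⟨v, hv⟩ := hξ (Pi.single a 1)
  have hva : ∀ b, ξ b v = (Pi.single a 1 : Fin k → ℝ) b := fun b => congrFun hv b
  simpa [hva, Pi.single_apply] using congrArg (fun φ : E →L[ℝ] ℝ => φ v) hμ

theorem finrank_range_conormalParam {E : Type} [NormedAddCommGroup E] [NormedSpace ℝ E]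
    [FiniteDimensional ℝ E] {k : ℕ} (H : E →L[ℝ] E →L[ℝ] ℝ) (ξ : Fin k → E →L[ℝ] ℝ)
    (hξ : Function.Surjective fun v : E => (fun a => ξ a v : Fin k → ℝ)) :
    Module.finrank ℝ (LinearMap.range (conormalParam H ξ)) = Module.finrank ℝ E := by
  have hrange : LinearMap.range (LinearMap.pi fun a => (ξ a : E →ₗ[ℝ] ℝ)) = ⊤ :=
    LinearMap.range_eq_top.2 hξ
  have h := LinearMap.finrank_range_add_finrank_ker (LinearMap.pi fun a => (ξ a : E →ₗ[ℝ] ℝ))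
  rw [hrange, finrank_top] at h
  rw [LinearMap.finrank_range_of_inj (conormalParam_injective H ξ hξ), Module.finrank_prod,
    add_comm, h]

theorem canSymp_conormalParam {E : Type} [NormedAddCommGroup E] [NormedSpace ℝ E] {k : ℕ}
    (H : E →L[ℝ] E →L[ℝ] ℝ) (hH : ∀ v w, H v w = H w v) (ξ : Fin k → E →L[ℝ] ℝ)
    (p q : LinearMap.ker (LinearMap.pi fun a => (ξ a : E →ₗ[ℝ] ℝ)) × (Fin k → ℝ)) :
    canSymp E (conormalParam H ξ p) (conormalParam H ξ q) = 0 := by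
  have hker (w : LinearMap.ker (LinearMap.pi fun a => (ξ a : E →ₗ[ℝ] ℝ))) (a : Fin k) :
      ξ a w = 0 := congrFun (LinearMap.mem_ker.1 w.2) a
  simp [canSymp, conormalParam_apply, hker, hH (p.1 : E) q.1]

theorem ContDiff.fderiv_fderiv_symm {E : Type} [NormedAddCommGroup E] [NormedSpace ℝ E]
    {f : E → ℝ} (hf : ContDiff ℝ 2 f) (x v w : E) :
    fderiv ℝ (fderiv ℝ f) x v w = fderiv ℝ (fderiv ℝ f) x w v :=
  (hf.contDiffAt.isSymmSndFDerivAt (by simp)).eq v w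

/-- constrained dynamics is Lagrangian, fibre version.
Let `g = (g₁,…,g_k) : E → ℝ^k` and `L̃ : E → ℝ` be `C²`, let `x` satisfy
`g(x) = 0` with `dg_x` surjective, and fix Lagrange multipliers `λ`.  Then the
set `T = {(w, D²L̃(x)(w,·) + Σ_a λ_a D²g_a(x)(w,·) + Σ_a μ_a (dg_a)_x) :
w ∈ ker dg_x, μ ∈ ℝ^k}` is a linear subspace of `E × E*` of dimension exactly
`dim E` on which the canonical symplectic form vanishes identically, i.e. a
Lagrangian subspace. -/
theorem statement_5 (E : Type) [NormedAddCommGroup E] [NormedSpace ℝ E]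
    [FiniteDimensional ℝ E] (k : ℕ)
    (g : Fin k → E → ℝ) (hg : ∀ a, ContDiff ℝ 2 (g a))
    (Lt : E → ℝ) (hLt : ContDiff ℝ 2 Lt)
    (x : E) (hx : ∀ a, g a x = 0)
    (hsurj : Function.Surjective
      (fun (v : E) => (fun a => fderiv ℝ (g a) x v : Fin k → ℝ)))
    (lam : Fin k → ℝ) :
    ∃ S : Submodule ℝ (E × (E →L[ℝ] ℝ)),
      (S : Set (E × (E →L[ℝ] ℝ)))
        = {uv | ∃ (w : E) (mu : Fin k → ℝ),
            (∀ a, fderiv ℝ (g a) x w = 0) ∧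
            uv = (w, fderiv ℝ (fderiv ℝ Lt) x w
                    + (∑ a, lam a • (fderiv ℝ (fderiv ℝ (g a)) x w))
                    + ∑ a, mu a • fderiv ℝ (g a) x)}
      ∧ Module.finrank ℝ ↥S = Module.finrank ℝ E
      ∧ ∀ u ∈ S, ∀ v ∈ S, canSymp E u v = 0 := by
  set H : E →L[ℝ] E →L[ℝ] ℝ :=
    fderiv ℝ (fderiv ℝ Lt) x + ∑ a, lam a • fderiv ℝ (fderiv ℝ (g a)) x with hH
  have hH_apply (w : E) : H w = fderiv ℝ (fderiv ℝ Lt) x w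
      + ∑ a, lam a • (fderiv ℝ (fderiv ℝ (g a)) x w) := by
    simp [hH]
  have hH_symm (v w : E) : H v w = H w v := by
    simp [hH_apply, hLt.fderiv_fderiv_symm x v w, fun a => (hg a).fderiv_fderiv_symm x v w]
  refine ⟨LinearMap.range (conormalParam H fun a => fderiv ℝ (g a) x), ?_,
    finrank_range_conormalParam H _ hsurj, ?_⟩
  · ext uv
    constructor
    · rintro ⟨⟨w, μ⟩, rfl⟩
      exact ⟨w, μ, fun a => congrFun (LinearMap.mem_ker.1 w.2) a, by
        rw [conormalParam_apply, hH_apply]⟩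
    · rintro ⟨w, μ, hw, rfl⟩
      exact ⟨(⟨w, LinearMap.mem_ker.2 (funext hw)⟩, μ), by rw [conormalParam_apply, hH_apply]⟩
  · rintro _ ⟨p, rfl⟩ _ ⟨q, rfl⟩
    exact canSymp_conormalParam H hH_symm _ p q
end
end

section
/- Let L be a smooth k-th order Lagrangian and φ : ℝ^n → ℝ a smooth function. Then the following are equivalent: (i) there exist smooth momenta p^{μ₁…μ_l λ} : ℝ^n → ℝ (0 ≤ l ≤ k−1, symmetric in μ₁…μ_l) such that the canonical first-order Euler–Lagrange system of L holds for (φ, p); (ii) φ satisfies the Euler–Lagrange equation of order 2k: Σ_{l=0}^{k} (−1)^l Σ_{μ₁,…,μ_l} ∂_{μ₁}⋯∂_{μ_l} [ (∂L/∂u_{μ₁…μ_l}) evaluated along the k-jet of φ ] = 0 identically on ℝ^n. Moreover, in case (ii) the momenta can be chosen totally symmetric, defined by the downward recursion p^{μ₁…μ_k} := ∂L/∂u_{μ₁…μ_k} and p^{μ₁…μ_l} := ∂L/∂u_{μ₁…μ_l} − Σ_λ ∂_λ p^{μ₁…μ_l λ} along the jet of φ. -/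
noncomputable section

open scoped BigOperators

/-- Points of the base `ℝⁿ`. -/
abbrev Vec (n : ℕ) : Type := Fin n → ℝ

/-- The space of jet variables `(u_{μ₁…μ_r})_{0 ≤ r ≤ k}` of order `≤ k`
(arrays indexed by tuples of indices). -/
abbrev JetU (n k : ℕ) : Type := ∀ r : Fin (k + 1), (Fin (r : ℕ) → Fin n) → ℝ

/-- The full variable space `(x^μ; u_{μ₁…μ_r}, 0 ≤ r ≤ k)` of a `k`-th order
Lagrangian. -/
abbrev Jet (n k : ℕ) : Type := Vec n × JetU n k

/-- Iterated partial derivative `∂_{t 0} ⋯ ∂_{t (l-1)} g` at `x`. -/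
def pderivIter (n l : ℕ) (t : Fin l → Fin n) (g : Vec n → ℝ) (x : Vec n) : ℝ :=
  iteratedFDeriv ℝ l g x fun i => Pi.single (t i) 1

/-- Partial derivative `∂_λ g` at `x`. -/
def pderiv1 (n : ℕ) (lam : Fin n) (g : Vec n → ℝ) (x : Vec n) : ℝ :=
  fderiv ℝ g x (Pi.single lam 1)

/-- The `k`-jet of `φ` at `x`: substitute `u_{μ₁…μ_r} = ∂_{μ₁}⋯∂_{μ_r} φ(x)`. -/
def jetEv (n k : ℕ) (φ : Vec n → ℝ) (x : Vec n) : Jet n k :=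
  (x, fun r t => pderivIter n (r : ℕ) t φ x)

/-- The symmetric array `∂L/∂u_{μ₁…μ_r}` (the array characterized by the fact
that its full contraction with a symmetric increment of the rank-`r` jet
variables is the corresponding directional derivative of `L`), evaluated at the
tuple `t` and the point `z`. -/
def dLdu (n k : ℕ) (L : Jet n k → ℝ) (r : Fin (k + 1)) (t : Fin (r : ℕ) → Fin n)
    (z : Jet n k) : ℝ :=
  ((r : ℕ).factorial : ℝ)⁻¹ *
    ∑ σ : Equiv.Perm (Fin (r : ℕ)),
      fderiv ℝ L z (0, Pi.single r (Pi.single (t ∘ σ) 1))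

/-- Total symmetrization `q^{(μ₁…μ_l λ)}` of a momentum array
`q^{μ₁…μ_l λ}`, evaluated at the length-`(l+1)` tuple `s`. -/
def symComb (n l : ℕ) (q : (Fin l → Fin n) → Fin n → ℝ) (s : Fin (l + 1) → Fin n) : ℝ :=
  ((l + 1).factorial : ℝ)⁻¹ *
    ∑ σ : Equiv.Perm (Fin (l + 1)),
      q (fun i => s (σ (Fin.castSucc i))) (s (σ (Fin.last l)))

/-- Momenta `p^{μ₁…μ_l λ}` (`0 ≤ l ≤ k−1`) for a `k`-th order theory:
fields on `ℝⁿ` indexed by a tuple `μ₁…μ_l` and an extra index `λ`. -/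
abbrev Mom (n k : ℕ) : Type := ∀ l : Fin k, (Fin (l : ℕ) → Fin n) → Fin n → Vec n → ℝ

/-- `C^∞` smoothness. -/
def IsCInf {E F : Type*} [NormedAddCommGroup E] [NormedSpace ℝ E]
    [NormedAddCommGroup F] [NormedSpace ℝ F] (f : E → F) : Prop :=
  ∀ m : ℕ, ContDiff ℝ m f

/-- All components of the momenta are smooth. -/
def MomSmooth (n k : ℕ) (p : Mom n k) : Prop :=
  ∀ (l : Fin k) (t : Fin (l : ℕ) → Fin n) (lam : Fin n), IsCInf (p l t lam)

/-- The momenta are symmetric in the indices `μ₁…μ_l`. -/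
def MomSym (n k : ℕ) (p : Mom n k) : Prop :=
  ∀ (l : Fin k) (σ : Equiv.Perm (Fin (l : ℕ))) (t : Fin (l : ℕ) → Fin n)
    (lam : Fin n) (x : Vec n), p l (t ∘ σ) lam x = p l t lam x

/-- The momenta are totally symmetric in all indices `μ₁…μ_l λ`. -/
def MomTotSym (n k : ℕ) (p : Mom n k) : Prop :=
  ∀ (l : Fin k) (σ : Equiv.Perm (Fin ((l : ℕ) + 1))) (s : Fin ((l : ℕ) + 1) → Fin n)
    (x : Vec n),
    p l (fun i => s (σ (Fin.castSucc i))) (s (σ (Fin.last (l : ℕ)))) x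
      = p l (fun i => s (Fin.castSucc i)) (s (Fin.last (l : ℕ))) x

/-- The canonical first-order Euler–Lagrange system of a `(K+1)`-th order
Lagrangian `L` for a pair `(φ, p)`:
`p^{(μ₁…μ_k)} = ∂L/∂u_{μ₁…μ_k}`;
`p^{(μ₁…μ_l)} = ∂L/∂u_{μ₁…μ_l} − Σ_λ ∂_λ p^{μ₁…μ_l λ}` for `1 ≤ l ≤ k−1`;
`0 = ∂L/∂u − Σ_λ ∂_λ p^λ`, all derivatives of `L` being evaluated along the
`k`-jet of `φ` (here `k = K+1`). -/
def CanonSys (n K : ℕ) (L : Jet n (K + 1) → ℝ) (φ : Vec n → ℝ) (p : Mom n (K + 1)) : Prop :=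
  (∀ x : Vec n,
      dLdu n (K + 1) L ⟨0, Nat.succ_pos _⟩ Fin.elim0 (jetEv n (K + 1) φ x)
        - ∑ lam : Fin n, pderiv1 n lam (p ⟨0, Nat.succ_pos _⟩ Fin.elim0 lam) x = 0)
  ∧ (∀ (l : Fin (K + 1)) (s : Fin ((l : ℕ) + 1) → Fin n) (x : Vec n),
      symComb n (l : ℕ) (fun t lam => p l t lam x) s
        = dLdu n (K + 1) L ⟨(l : ℕ) + 1, Nat.succ_lt_succ l.isLt⟩ s (jetEv n (K + 1) φ x)
          - if h : (l : ℕ) + 1 < K + 1 then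
              ∑ lam : Fin n, pderiv1 n lam (p ⟨(l : ℕ) + 1, h⟩ s lam) x
            else 0)

/-- The Euler–Lagrange equation of order `2k` (`k = K+1`) of `L` for `φ`:
`Σ_{r=0}^{k} (−1)^r Σ_{μ₁…μ_r} ∂_{μ₁}⋯∂_{μ_r}[∂L/∂u_{μ₁…μ_r} ∘ (k-jet of φ)] = 0`. -/
def ELeq (n K : ℕ) (L : Jet n (K + 1) → ℝ) (φ : Vec n → ℝ) : Prop :=
  ∀ x : Vec n,
    ∑ r : Fin (K + 2),
      ((-1 : ℝ) ^ (r : ℕ)) *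
        ∑ t : Fin (r : ℕ) → Fin n,
          pderivIter n (r : ℕ) t
            (fun y => dLdu n (K + 1) L r t (jetEv n (K + 1) φ y)) x
      = 0

open scoped ContDiff

theorem isCInf_iff_contDiff {E F : Type*} [NormedAddCommGroup E] [NormedSpace ℝ E]
    [NormedAddCommGroup F] [NormedSpace ℝ F] {f : E → F} : IsCInf f ↔ ContDiff ℝ ∞ f :=
  contDiff_infty.symm

section PartialDerivatives

variable {n : ℕ}

theorem contDiff_pderiv1 {g : Vec n → ℝ} (hg : ContDiff ℝ ∞ g) (lam : Fin n) :
    ContDiff ℝ ∞ (pderiv1 n lam g) :=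
  (hg.fderiv_right (m := ∞) le_rfl).clm_apply contDiff_const

theorem contDiff_pderivIter {g : Vec n → ℝ} (hg : ContDiff ℝ ∞ g) (l : ℕ) (t : Fin l → Fin n) :
    ContDiff ℝ ∞ (pderivIter n l t g) :=
  (ContinuousMultilinearMap.apply ℝ (fun _ : Fin l => Vec n) ℝ
    fun i => Pi.single (t i) 1).contDiff.comp
      (hg.iteratedFDeriv_right (m := ∞) (i := l) (by norm_cast))

theorem pderivIter_zero (t : Fin 0 → Fin n) (g : Vec n → ℝ) (x : Vec n) :
    pderivIter n 0 t g x = g x := by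
  simp [pderivIter]

theorem pderivIter_succ {g : Vec n → ℝ} (hg : ContDiff ℝ ∞ g) {l : ℕ} (t : Fin (l + 1) → Fin n)
    (x : Vec n) :
    pderivIter n (l + 1) t g x
      = pderivIter n l (fun i => t (Fin.castSucc i)) (pderiv1 n (t (Fin.last l)) g) x := by
  have h := (ContinuousLinearMap.apply ℝ ℝ
    (Pi.single (t (Fin.last l)) 1 : Vec n)).iteratedFDeriv_comp_left
      (hg.fderiv_right (m := ∞) le_rfl).contDiffAt (x := x) (i := l) (by norm_cast; exact le_top)
  change _ = iteratedFDeriv ℝ l (⇑(ContinuousLinearMap.apply ℝ ℝ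
    (Pi.single (t (Fin.last l)) 1 : Vec n)) ∘ fderiv ℝ g) x _
  rw [h, pderivIter, iteratedFDeriv_succ_apply_right]
  rfl

theorem pderivIter_sub {f g : Vec n → ℝ} (hf : ContDiff ℝ ∞ f) (hg : ContDiff ℝ ∞ g) {l : ℕ}
    (t : Fin l → Fin n) (x : Vec n) :
    pderivIter n l t (fun y => f y - g y) x = pderivIter n l t f x - pderivIter n l t g x := by
  have h : iteratedFDeriv ℝ l (f - g) x = iteratedFDeriv ℝ l f x - iteratedFDeriv ℝ l g x :=
    iteratedFDeriv_sub_apply (hf.of_le (by norm_cast; exact le_top)).contDiffAt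
      (hg.of_le (by norm_cast; exact le_top)).contDiffAt
  change iteratedFDeriv ℝ l (f - g) x _ = _
  rw [h]
  rfl

theorem pderivIter_sum {ι : Type*} (u : Finset ι) {f : ι → Vec n → ℝ}
    (hf : ∀ i, ContDiff ℝ ∞ (f i)) {l : ℕ} (t : Fin l → Fin n) (x : Vec n) :
    pderivIter n l t (fun y => ∑ i ∈ u, f i y) x = ∑ i ∈ u, pderivIter n l t (f i) x := by
  have h := iteratedFDeriv_fun_sum_apply (𝕜 := ℝ) (f := f) (u := u) (n := l) (x := x)
    fun j _ => ((hf j).of_le (by norm_cast; exact le_top)).contDiffAt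
  rw [pderivIter, h, sum_apply]
  rfl

theorem pderivIter_const_mul {f : Vec n → ℝ} (hf : ContDiff ℝ ∞ f) (c : ℝ) {l : ℕ}
    (t : Fin l → Fin n) (x : Vec n) :
    pderivIter n l t (fun y => c * f y) x = c * pderivIter n l t f x := by
  have h : iteratedFDeriv ℝ l (c • f) x = c • iteratedFDeriv ℝ l f x :=
    iteratedFDeriv_const_smul_apply (hf.of_le (by norm_cast; exact le_top)).contDiffAt
  change iteratedFDeriv ℝ l (c • f) x _ = _
  rw [h]
  rfl

theorem pderiv1_comm {g : Vec n → ℝ} (hg : ContDiff ℝ ∞ g) (a b : Fin n) :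
    pderiv1 n a (pderiv1 n b g) = pderiv1 n b (pderiv1 n a g) := by
  have hd : Differentiable ℝ (fderiv ℝ g) :=
    (hg.fderiv_right (m := ∞) le_rfl).differentiable (by simp)
  have second (a b : Fin n) (x : Vec n) : pderiv1 n a (pderiv1 n b g) x
      = fderiv ℝ (fderiv ℝ g) x (Pi.single a 1) (Pi.single b 1) := by
    change fderiv ℝ (fun y => fderiv ℝ g y (Pi.single b 1)) x (Pi.single a 1) = _
    simp [fderiv_clm_apply (hd x) (differentiableAt_const _)]
  funext x
  rw [second, second]
  exact hg.contDiffAt.isSymmSndFDerivAt (by simpa using ENat.LEInfty.out) _ _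

/-- The operator `∂_λ` on smooth functions. -/
def smoothPderiv (lam : Fin n) (g : {g : Vec n → ℝ // ContDiff ℝ ∞ g}) :
    {g : Vec n → ℝ // ContDiff ℝ ∞ g} :=
  ⟨pderiv1 n lam g, contDiff_pderiv1 g.2 lam⟩

instance : LeftCommutative (smoothPderiv (n := n)) :=
  ⟨fun a b g => Subtype.ext (pderiv1_comm g.2 a b)⟩

theorem pderivIter_eq_foldr (g : {g : Vec n → ℝ // ContDiff ℝ ∞ g}) {l : ℕ} (t : Fin l → Fin n)
    (x : Vec n) :
    pderivIter n l t g x = ((List.ofFn t).foldr smoothPderiv g).1 x := by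
  induction l generalizing g with
  | zero => simp [pderivIter_zero]
  | succ l ih =>
    rw [pderivIter_succ g.2, List.ofFn_succ', List.concat_eq_append, List.foldr_concat]
    exact ih (smoothPderiv (t (Fin.last l)) g) _

theorem pderivIter_comp_perm {g : Vec n → ℝ} (hg : ContDiff ℝ ∞ g) {l : ℕ} (t : Fin l → Fin n)
    (σ : Equiv.Perm (Fin l)) (x : Vec n) :
    pderivIter n l (t ∘ σ) g x = pderivIter n l t g x := by
  rw [pderivIter_eq_foldr ⟨g, hg⟩, pderivIter_eq_foldr ⟨g, hg⟩,
    (σ.ofFn_comp_perm t).foldr_eq]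

/-- The full divergence only sees the total symmetrization of an array. -/
theorem sum_pderivIter_symComb {l : ℕ} {q : (Fin l → Fin n) → Fin n → Vec n → ℝ}
    (hq : ∀ t lam, ContDiff ℝ ∞ (q t lam)) (x : Vec n) :
    ∑ s : Fin (l + 1) → Fin n,
        pderivIter n (l + 1) s (fun y => symComb n l (fun t lam => q t lam y) s) x
      = ∑ s : Fin (l + 1) → Fin n,
        pderivIter n (l + 1) s (q (fun i => s (Fin.castSucc i)) (s (Fin.last l))) x := by
  have expand (s : Fin (l + 1) → Fin n) :
      pderivIter n (l + 1) s (fun y => symComb n l (fun t lam => q t lam y) s) x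
        = ((l + 1).factorial : ℝ)⁻¹ * ∑ σ : Equiv.Perm (Fin (l + 1)),
          pderivIter n (l + 1) (s ∘ σ)
            (q (fun i => s (σ (Fin.castSucc i))) (s (σ (Fin.last l)))) x := by
    unfold symComb
    rw [pderivIter_const_mul (ContDiff.sum fun σ _ => hq _ _), pderivIter_sum _ fun σ => hq _ _]
    simp_rw [pderivIter_comp_perm (hq _ _)]
  have reindex (σ : Equiv.Perm (Fin (l + 1))) :
      ∑ s : Fin (l + 1) → Fin n, pderivIter n (l + 1) (s ∘ σ)
          (q (fun i => s (σ (Fin.castSucc i))) (s (σ (Fin.last l)))) x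
        = ∑ s : Fin (l + 1) → Fin n,
          pderivIter n (l + 1) s (q (fun i => s (Fin.castSucc i)) (s (Fin.last l))) x :=
    Fintype.sum_equiv (σ.symm.arrowCongr (Equiv.refl (Fin n))) _ _ fun s => rfl
  simp_rw [expand]
  rw [← Finset.mul_sum, Finset.sum_comm]
  simp_rw [reindex]
  rw [Finset.sum_const, Finset.card_univ, Fintype.card_perm, Fintype.card_fin, nsmul_eq_mul,
    inv_mul_cancel_left₀ (by positivity)]

/-- The full divergence of an array, with the innermost derivative split off. -/
theorem sum_pderivIter_succ {l : ℕ} {q : (Fin l → Fin n) → Fin n → Vec n → ℝ}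
    (hq : ∀ t lam, ContDiff ℝ ∞ (q t lam)) (x : Vec n) :
    ∑ s : Fin (l + 1) → Fin n,
        pderivIter n (l + 1) s (q (fun i => s (Fin.castSucc i)) (s (Fin.last l))) x
      = ∑ t : Fin l → Fin n,
        pderivIter n l t (fun y => ∑ lam, pderiv1 n lam (q t lam) y) x := by
  simp_rw [pderivIter_sum _ fun lam => contDiff_pderiv1 (hq _ lam) lam,
    pderivIter_succ (hq _ _)]
  rw [← Fintype.sum_prod_type', ← (Equiv.prodComm (Fin n) (Fin l → Fin n)).sum_comp]
  refine (Fintype.sum_equiv (Fin.snocEquiv fun _ : Fin (l + 1) => Fin n) _ _ ?_).symm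
  rintro ⟨lam, t⟩
  simp [Fin.snocEquiv]

end PartialDerivatives

section Lagrangian

variable {n k : ℕ}

theorem contDiff_jetEv {φ : Vec n → ℝ} (hφ : ContDiff ℝ ∞ φ) : ContDiff ℝ ∞ (jetEv n k φ) :=
  contDiff_id.prodMk (contDiff_pi.2 fun r => contDiff_pi.2 fun t => contDiff_pderivIter hφ r t)

theorem contDiff_dLdu_jetEv {L : Jet n k → ℝ} (hL : ContDiff ℝ ∞ L) {φ : Vec n → ℝ}
    (hφ : ContDiff ℝ ∞ φ) (r : Fin (k + 1)) (t : Fin (r : ℕ) → Fin n) :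
    ContDiff ℝ ∞ fun x => dLdu n k L r t (jetEv n k φ x) :=
  contDiff_const.mul (ContDiff.sum fun _ _ =>
    ((hL.fderiv_right (m := ∞) le_rfl).comp (contDiff_jetEv hφ)).clm_apply contDiff_const)

theorem dLdu_comp_perm (L : Jet n k → ℝ) (r : Fin (k + 1)) (t : Fin (r : ℕ) → Fin n)
    (τ : Equiv.Perm (Fin (r : ℕ))) (z : Jet n k) : dLdu n k L r (t ∘ τ) z = dLdu n k L r t z := by
  unfold dLdu
  congr 1
  exact Fintype.sum_equiv (Equiv.mulLeft τ) _ _ fun σ => rfl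

end Lagrangian

section Telescoping

theorem sum_range_neg_one_pow_mul_add_succ (B : ℕ → ℝ) (N : ℕ) :
    ∑ m ∈ Finset.range N, (-1 : ℝ) ^ (m + 1) * (B m + B (m + 1)) = -B 0 + (-1) ^ N * B N := by
  induction N with
  | zero => simp
  | succ N ih => rw [Finset.sum_range_succ, ih]; ring

/-- If the momenta satisfy the equations of positive rank of the canonical system, then the
Euler–Lagrange expression equals the rank-zero expression of the canonical system. -/
theorem eulerLagrange_eq_of_canonical {n K : ℕ} {L : Jet n (K + 1) → ℝ} (hL : ContDiff ℝ ∞ L)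
    {φ : Vec n → ℝ} (hφ : ContDiff ℝ ∞ φ) {p : Mom n (K + 1)}
    (hp : ∀ l t lam, ContDiff ℝ ∞ (p l t lam))
    (h : ∀ (l : Fin (K + 1)) (s : Fin ((l : ℕ) + 1) → Fin n) (x : Vec n),
      symComb n (l : ℕ) (fun t lam => p l t lam x) s
        = dLdu n (K + 1) L ⟨(l : ℕ) + 1, Nat.succ_lt_succ l.isLt⟩ s (jetEv n (K + 1) φ x)
          - if h : (l : ℕ) + 1 < K + 1 then
              ∑ lam : Fin n, pderiv1 n lam (p ⟨(l : ℕ) + 1, h⟩ s lam) x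
            else 0) (x : Vec n) :
    ∑ r : Fin (K + 2), ((-1 : ℝ) ^ (r : ℕ)) * ∑ t : Fin (r : ℕ) → Fin n,
        pderivIter n (r : ℕ) t (fun y => dLdu n (K + 1) L r t (jetEv n (K + 1) φ y)) x
      = dLdu n (K + 1) L ⟨0, Nat.succ_pos _⟩ Fin.elim0 (jetEv n (K + 1) φ x)
        - ∑ lam : Fin n, pderiv1 n lam (p ⟨0, Nat.succ_pos _⟩ Fin.elim0 lam) x := by
  let B : ℕ → ℝ := fun m => if hm : m < K + 1 then
    ∑ t : Fin m → Fin n, pderivIter n m t (fun y => ∑ lam, pderiv1 n lam (p ⟨m, hm⟩ t lam) y) x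
    else 0
  have step (l : Fin (K + 1)) :
      ∑ s : Fin ((l : ℕ) + 1) → Fin n, pderivIter n ((l : ℕ) + 1) s
        (fun y => dLdu n (K + 1) L ⟨(l : ℕ) + 1, Nat.succ_lt_succ l.isLt⟩ s
          (jetEv n (K + 1) φ y)) x = B l + B (l + 1) := by
    have hBl : B l = ∑ s : Fin ((l : ℕ) + 1) → Fin n, pderivIter n ((l : ℕ) + 1) s
        (fun y => symComb n (l : ℕ) (fun t lam => p l t lam y) s) x := by
      rw [sum_pderivIter_symComb (hp l), sum_pderivIter_succ (hp l)]
      simp [B, Nat.lt_succ_iff.1 l.isLt]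
    rw [hBl]
    by_cases hl : (l : ℕ) + 1 < K + 1
    · have hBs : B (l + 1) = ∑ s : Fin ((l : ℕ) + 1) → Fin n, pderivIter n ((l : ℕ) + 1) s
          (fun y => ∑ lam, pderiv1 n lam (p ⟨(l : ℕ) + 1, hl⟩ s lam) y) x := dif_pos hl
      rw [hBs, ← Finset.sum_add_distrib]
      refine Finset.sum_congr rfl fun s _ => ?_
      simp_rw [h l s, dif_pos hl]
      rw [pderivIter_sub (contDiff_dLdu_jetEv hL hφ _ _)
        (ContDiff.sum fun lam _ => contDiff_pderiv1 (hp _ _ _) _), sub_add_cancel]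
    · have hBs : B (l + 1) = 0 := dif_neg hl
      rw [hBs, add_zero]
      refine Finset.sum_congr rfl fun s _ => ?_
      simp_rw [h l s, dif_neg hl, sub_zero]
  have hB0 : B 0 = ∑ lam : Fin n, pderiv1 n lam (p ⟨0, Nat.succ_pos _⟩ Fin.elim0 lam) x := by
    simp [B, pderivIter_zero, Subsingleton.elim (default : Fin 0 → Fin n) Fin.elim0]
  have hBK : B (K + 1) = 0 := dif_neg (lt_irrefl _)
  have hpos : ∑ l : Fin (K + 1), ((-1 : ℝ) ^ (l.succ : ℕ)) * ∑ t : Fin (l.succ : ℕ) → Fin n,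
      pderivIter n (l.succ : ℕ) t
        (fun y => dLdu n (K + 1) L l.succ t (jetEv n (K + 1) φ y)) x = -B 0 := by
    calc _ = ∑ l : Fin (K + 1), (-1 : ℝ) ^ ((l : ℕ) + 1) * (B l + B (l + 1)) :=
          Finset.sum_congr rfl fun l _ => congrArg (_ * ·) (step l)
      _ = -B 0 := by
          rw [Fin.sum_univ_eq_sum_range fun m => (-1 : ℝ) ^ (m + 1) * (B m + B (m + 1)),
            sum_range_neg_one_pow_mul_add_succ, hBK, mul_zero, add_zero]
  have hzero : ∑ t : Fin ((0 : Fin (K + 2)) : ℕ) → Fin n, pderivIter n ((0 : Fin (K + 2)) : ℕ) t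
      (fun y => dLdu n (K + 1) L 0 t (jetEv n (K + 1) φ y)) x
        = dLdu n (K + 1) L ⟨0, Nat.succ_pos _⟩ Fin.elim0 (jetEv n (K + 1) φ x) := by
    change ∑ t : Fin 0 → Fin n, pderivIter n 0 t
      (fun y => dLdu n (K + 1) L ⟨0, Nat.succ_pos _⟩ t (jetEv n (K + 1) φ y)) x = _
    simp_rw [pderivIter_zero]
    rw [Fintype.sum_unique, Subsingleton.elim (default : Fin 0 → Fin n) Fin.elim0]
  rw [Fin.sum_univ_succ, hpos, hzero, hB0, Fin.val_zero, pow_zero, one_mul, sub_eq_add_neg]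

end Telescoping

section DownwardRecursion

variable {n : ℕ}

/-- The downward recursion `P^{t} = F^{t} − Σ_λ ∂_λ P^{tλ}`, started `j` ranks above. -/
def downRec (F : ∀ r : ℕ, (Fin r → Fin n) → Vec n → ℝ) :
    ℕ → ∀ r : ℕ, (Fin r → Fin n) → Vec n → ℝ
  | 0, r, t, x => F r t x
  | j + 1, r, t, x => F r t x
      - ∑ lam : Fin n, pderiv1 n lam (downRec F j (r + 1) (Fin.snoc (α := fun _ => Fin n) t lam)) x

variable {F : ∀ r : ℕ, (Fin r → Fin n) → Vec n → ℝ}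

theorem contDiff_downRec (hF : ∀ r t, ContDiff ℝ ∞ (F r t)) (j r : ℕ) (t : Fin r → Fin n) :
    ContDiff ℝ ∞ (downRec F j r t) := by
  induction j generalizing r with
  | zero => exact hF r t
  | succ j ih => exact (hF r t).sub (ContDiff.sum fun lam _ => contDiff_pderiv1 (ih _ _) lam)

theorem exists_perm_snoc_comp {l : ℕ} (σ : Equiv.Perm (Fin l)) : ∃ τ : Equiv.Perm (Fin (l + 1)),
    (∀ i, τ (Fin.castSucc i) = Fin.castSucc (σ i)) ∧ τ (Fin.last l) = Fin.last l :=
  ⟨(finSuccEquivLast.trans (Equiv.optionCongr σ)).trans finSuccEquivLast.symm, by simp, by simp⟩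

theorem downRec_comp_perm (hF : ∀ r t (σ : Equiv.Perm (Fin r)), F r (t ∘ σ) = F r t) (j r : ℕ)
    (t : Fin r → Fin n) (σ : Equiv.Perm (Fin r)) :
    downRec F j r (t ∘ σ) = downRec F j r t := by
  induction j generalizing r with
  | zero => exact hF r t σ
  | succ j ih =>
    obtain ⟨τ, hτ, hτ'⟩ := exists_perm_snoc_comp σ
    have hsnoc (lam : Fin n) : Fin.snoc (α := fun _ => Fin n) (t ∘ σ) lam
        = Fin.snoc (α := fun _ => Fin n) t lam ∘ τ := by
      ext i
      refine Fin.lastCases ?_ (fun i => ?_) i <;> simp [hτ, hτ']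
    funext x
    simp only [downRec, hsnoc, ih, hF]

end DownwardRecursion

theorem snoc_castSucc_last {α : Type*} {l : ℕ} (s : Fin (l + 1) → α) :
    Fin.snoc (α := fun _ => α) (fun i => s (Fin.castSucc i)) (s (Fin.last l)) = s :=
  Fin.snoc_init_self s

theorem MomTotSym.momSym {n k : ℕ} {p : Mom n k} (hp : MomTotSym n k p) : MomSym n k p := by
  intro l σ t lam x
  obtain ⟨τ, hτ, hτ'⟩ := exists_perm_snoc_comp σ
  have h := hp l τ (Fin.snoc (α := fun _ => Fin n) t lam) x
  simpa [hτ, hτ', Function.comp_def] using h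

theorem symComb_of_totSym {n l : ℕ} {q : (Fin l → Fin n) → Fin n → ℝ} {s : Fin (l + 1) → Fin n}
    (hq : ∀ σ : Equiv.Perm (Fin (l + 1)),
      q (fun i => s (σ (Fin.castSucc i))) (s (σ (Fin.last l)))
        = q (fun i => s (Fin.castSucc i)) (s (Fin.last l))) :
    symComb n l q s = q (fun i => s (Fin.castSucc i)) (s (Fin.last l)) := by
  unfold symComb
  simp_rw [hq]
  rw [Finset.sum_const, Finset.card_univ, Fintype.card_perm, Fintype.card_fin, nsmul_eq_mul,
    inv_mul_cancel_left₀ (by positivity)]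

/-- The downward recursion defines smooth totally symmetric momenta. -/
theorem exists_recursive_momenta {n K : ℕ} {L : Jet n (K + 1) → ℝ} (hL : ContDiff ℝ ∞ L)
    {φ : Vec n → ℝ} (hφ : ContDiff ℝ ∞ φ) :
    ∃ p : Mom n (K + 1), (∀ l t lam, ContDiff ℝ ∞ (p l t lam)) ∧ MomTotSym n (K + 1) p ∧
      ∀ (l : Fin (K + 1)) (s : Fin ((l : ℕ) + 1) → Fin n) (x : Vec n),
        p l (fun i => s (Fin.castSucc i)) (s (Fin.last (l : ℕ))) x
          = dLdu n (K + 1) L ⟨(l : ℕ) + 1, Nat.succ_lt_succ l.isLt⟩ s (jetEv n (K + 1) φ x)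
            - if h : (l : ℕ) + 1 < K + 1 then
                ∑ lam : Fin n, pderiv1 n lam (p ⟨(l : ℕ) + 1, h⟩ s lam) x
              else 0 := by
  let F : ∀ r : ℕ, (Fin r → Fin n) → Vec n → ℝ := fun r t x =>
    if h : r < K + 2 then dLdu n (K + 1) L ⟨r, h⟩ t (jetEv n (K + 1) φ x) else 0
  have hF (r : ℕ) (t : Fin r → Fin n) : ContDiff ℝ ∞ (F r t) := by
    by_cases h : r < K + 2
    · simpa only [F, dif_pos h] using contDiff_dLdu_jetEv hL hφ ⟨r, h⟩ t
    · simpa only [F, dif_neg h] using contDiff_const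
  have hFσ (r : ℕ) (t : Fin r → Fin n) (σ : Equiv.Perm (Fin r)) : F r (t ∘ σ) = F r t := by
    funext x
    by_cases h : r < K + 2
    · simpa only [F, dif_pos h] using dLdu_comp_perm L ⟨r, h⟩ t σ _
    · simp only [F, dif_neg h]
  refine ⟨fun l t lam => downRec F (K - l) (l + 1) (Fin.snoc (α := fun _ => Fin n) t lam),
    fun l t lam => contDiff_downRec hF _ _ _, fun l σ s x => ?_, fun l s x => ?_⟩
  · have h := snoc_castSucc_last (s ∘ σ)
    simp only [Function.comp_apply] at h
    simp only [h, snoc_castSucc_last, downRec_comp_perm hFσ]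
  · have hFl : F (l + 1) s x
        = dLdu n (K + 1) L ⟨(l : ℕ) + 1, Nat.succ_lt_succ l.isLt⟩ s (jetEv n (K + 1) φ x) :=
      dif_pos (Nat.succ_lt_succ l.isLt)
    simp only [snoc_castSucc_last]
    by_cases h : (l : ℕ) + 1 < K + 1
    · rw [dif_pos h, show K - (l : ℕ) = K - (l + 1) + 1 by omega, downRec, hFl]
    · rw [dif_neg h, show K - (l : ℕ) = 0 by omega, downRec, hFl, sub_zero]

/-- higher-order Euler–Lagrange equations as a first-order
canonical system.  For a smooth `k`-th order Lagrangian `L` (`k = K+1 ≥ 1`)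
and a smooth `φ : ℝⁿ → ℝ`: the existence of smooth momenta `p^{μ₁…μ_l λ}`
(symmetric in `μ₁…μ_l`) satisfying the canonical first-order Euler–Lagrange
system of `L` is equivalent to the Euler–Lagrange equation of order `2k` for
`φ`.  Moreover, in that case the momenta can be chosen totally symmetric,
defined by the downward recursion `p^{μ₁…μ_k} := ∂L/∂u_{μ₁…μ_k}` and
`p^{μ₁…μ_l} := ∂L/∂u_{μ₁…μ_l} − Σ_λ ∂_λ p^{μ₁…μ_l λ}` along the jet of `φ`. -/
theorem statement_7 (n K : ℕ) (hn : 1 ≤ n)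
    (L : Jet n (K + 1) → ℝ) (hL : IsCInf L)
    (φ : Vec n → ℝ) (hφ : IsCInf φ) :
    ((∃ p : Mom n (K + 1),
        MomSmooth n (K + 1) p ∧ MomSym n (K + 1) p ∧ CanonSys n K L φ p)
      ↔ ELeq n K L φ)
    ∧ (ELeq n K L φ →
        ∃ p : Mom n (K + 1),
          MomSmooth n (K + 1) p
          ∧ MomTotSym n (K + 1) p
          -- top of the downward recursion: p^{μ₁…μ_k} = ∂L/∂u_{μ₁…μ_k}
          ∧ (∀ (l : Fin (K + 1)), (l : ℕ) + 1 = K + 1 →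
              ∀ (s : Fin ((l : ℕ) + 1) → Fin n) (x : Vec n),
                p l (fun i => s (Fin.castSucc i)) (s (Fin.last (l : ℕ))) x
                  = dLdu n (K + 1) L ⟨(l : ℕ) + 1, Nat.succ_lt_succ l.isLt⟩ s
                      (jetEv n (K + 1) φ x))
          -- downward recursion: p^{μ₁…μ_l} = ∂L/∂u_{μ₁…μ_l} − Σ_λ ∂_λ p^{μ₁…μ_l λ}
          ∧ (∀ (l : Fin (K + 1)) (h : (l : ℕ) + 1 < K + 1)
              (s : Fin ((l : ℕ) + 1) → Fin n) (x : Vec n),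
                p l (fun i => s (Fin.castSucc i)) (s (Fin.last (l : ℕ))) x
                  = dLdu n (K + 1) L ⟨(l : ℕ) + 1, Nat.succ_lt_succ l.isLt⟩ s
                      (jetEv n (K + 1) φ x)
                    - ∑ lam : Fin n, pderiv1 n lam (p ⟨(l : ℕ) + 1, h⟩ s lam) x)
          ∧ CanonSys n K L φ p) := by
  rw [isCInf_iff_contDiff] at hL hφ
  obtain ⟨p, hp, hsym, hrec⟩ := exists_recursive_momenta hL hφ
  have hp' : MomSmooth n (K + 1) p := fun l t lam => isCInf_iff_contDiff.2 (hp l t lam)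
  have hcan (l : Fin (K + 1)) (s : Fin ((l : ℕ) + 1) → Fin n) (x : Vec n) :=
    (symComb_of_totSym (q := fun t lam => p l t lam x) fun σ => hsym l σ s x).trans (hrec l s x)
  have hsys (hEL : ELeq n K L φ) : CanonSys n K L φ p :=
    ⟨fun x => (eulerLagrange_eq_of_canonical hL hφ hp hcan x).symm.trans (hEL x), hcan⟩
  refine ⟨⟨?_, fun hEL => ⟨p, hp', hsym.momSym, hsys hEL⟩⟩, fun hEL =>
    ⟨p, hp', hsym, fun l h s x => ?_, fun l h s x => ?_, hsys hEL⟩⟩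
  · rintro ⟨q, hq, -, hzero, hqcan⟩ x
    exact (eulerLagrange_eq_of_canonical hL hφ
      (fun l t lam => isCInf_iff_contDiff.1 (hq l t lam)) hqcan x).trans (hzero x)
  · rw [hrec, dif_neg h.not_lt, sub_zero]
  · rw [hrec, dif_pos h]
end
end
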